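/- Let A be a nonzero m×n real matrix and let |||·||| be any norm on the space of m×n real matrices with dual norm |||·|||*. Then the problem: minimize |||X||| subject to ⟨A,X⟩ ≥ 1, has a unique optimal solution if and only if the dual norm function |||·|||* is differentiable at A. -/

import Mathlib

open scoped BigOperators

noncomputable section

namespace LAROS

variable {m n : ℕ}

/-- Trace inner product `⟨A,X⟩ = trace(Aᵀ X)`. -/
def mInner (A X : Matrix (Fin m) (Fin n) ℝ) : ℝ := ∑ i, ∑ j, A i j * X i j

/-- `N` is a norm on `m×n` real matrices. -/
def IsMatrixNorm (N : Matrix (Fin m) (Fin n) ℝ → ℝ) : Prop :=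
  (∀ X, N X = 0 ↔ X = 0) ∧ (∀ (c : ℝ) (X), N (c • X) = |c| * N X) ∧
    (∀ X Y, N (X + Y) ≤ N X + N Y)

/-- Dual norm of `N`. -/
def dualNorm (N : Matrix (Fin m) (Fin n) ℝ → ℝ) (A : Matrix (Fin m) (Fin n) ℝ) : ℝ :=
  sSup {r | ∃ Y, N Y ≤ 1 ∧ r = mInner A Y}

/-- `X` is optimal for: minimize `N X` subject to `⟨A,X⟩ ≥ 1`. -/
def IsOptMin (N : Matrix (Fin m) (Fin n) ℝ → ℝ) (A X : Matrix (Fin m) (Fin n) ℝ) : Prop :=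
  1 ≤ mInner A X ∧ ∀ X', 1 ≤ mInner A X' → N X ≤ N X'

/-- `Y` is optimal for: maximize `⟨A,Y⟩` subject to `N Y ≤ 1`. -/
def IsOptMax (N : Matrix (Fin m) (Fin n) ℝ → ℝ) (A Y : Matrix (Fin m) (Fin n) ℝ) : Prop :=
  N Y ≤ 1 ∧ ∀ Y', N Y' ≤ 1 → mInner A Y' ≤ mInner A Y

/-- Subdifferential of `f : ℝ^{m×n} → ℝ` at `A`, with respect to the trace inner product. -/
def subdiff (f : Matrix (Fin m) (Fin n) ℝ → ℝ) (A : Matrix (Fin m) (Fin n) ℝ) :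
    Set (Matrix (Fin m) (Fin n) ℝ) :=
  {Y | ∀ B, f A + mInner (B - A) Y ≤ f B}

attribute [local instance] Matrix.normedAddCommGroup Matrix.normedSpace

lemma mInner_add_left (A B X : Matrix (Fin m) (Fin n) ℝ) :
    mInner (A + B) X = mInner A X + mInner B X := by
  simp [mInner, add_mul, Finset.sum_add_distrib]

lemma mInner_sub_left (A B X : Matrix (Fin m) (Fin n) ℝ) :
    mInner (A - B) X = mInner A X - mInner B X := by
  simp [mInner, sub_mul, Finset.sum_sub_distrib]

lemma mInner_sub_right (A X Y : Matrix (Fin m) (Fin n) ℝ) :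
    mInner A (X - Y) = mInner A X - mInner A Y := by
  simp [mInner, mul_sub, Finset.sum_sub_distrib]

lemma mInner_smul_left (c : ℝ) (A X : Matrix (Fin m) (Fin n) ℝ) :
    mInner (c • A) X = c * mInner A X := by
  simp [mInner, Finset.mul_sum, mul_assoc]

lemma mInner_smul_right (c : ℝ) (A X : Matrix (Fin m) (Fin n) ℝ) :
    mInner A (c • X) = c * mInner A X := by
  simp [mInner, Finset.mul_sum, mul_left_comm]

lemma mInner_self_nonneg (A : Matrix (Fin m) (Fin n) ℝ) : 0 ≤ mInner A A :=
  Finset.sum_nonneg fun _ _ => Finset.sum_nonneg fun _ _ => mul_self_nonneg _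

lemma mInner_self_eq_zero {A : Matrix (Fin m) (Fin n) ℝ} : mInner A A = 0 ↔ A = 0 := by
  refine ⟨fun h => ?_, fun h => by simp [h, mInner]⟩
  ext i j
  have hi := (Finset.sum_eq_zero_iff_of_nonneg fun i _ =>
    Finset.sum_nonneg fun j _ => mul_self_nonneg (A i j)).1 h i (Finset.mem_univ i)
  have hj := (Finset.sum_eq_zero_iff_of_nonneg fun j _ => mul_self_nonneg (A i j)).1 hi j
    (Finset.mem_univ j)
  simpa using hj

lemma continuous_mInner_right (A : Matrix (Fin m) (Fin n) ℝ) : Continuous (mInner A) := by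
  unfold mInner
  fun_prop

/-- The functional `⟨·, Y⟩` as a continuous linear map. -/
def mInnerCLM (Y : Matrix (Fin m) (Fin n) ℝ) : Matrix (Fin m) (Fin n) ℝ →L[ℝ] ℝ :=
  LinearMap.toContinuousLinearMap
    { toFun := fun B => mInner B Y
      map_add' := fun A B => mInner_add_left A B Y
      map_smul' := fun c A => mInner_smul_left c A Y }

@[simp]
lemma mInnerCLM_apply (Y B : Matrix (Fin m) (Fin n) ℝ) : mInnerCLM Y B = mInner B Y := rfl

lemma mInnerCLM_injective :
    Function.Injective (mInnerCLM : Matrix (Fin m) (Fin n) ℝ → _) := by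
  intro X Y h
  have h' := congrArg (fun L => L (X - Y)) h
  rw [← sub_eq_zero, ← mInner_self_eq_zero, mInner_sub_right]
  simpa [sub_eq_zero] using h'

lemma abs_mInner_le (A X : Matrix (Fin m) (Fin n) ℝ) :
    |mInner A X| ≤ m * n * ‖A‖ * ‖X‖ := by
  calc |mInner A X| ≤ ∑ i, ∑ j, |A i j * X i j| :=
        (Finset.abs_sum_le_sum_abs _ _).trans
          (Finset.sum_le_sum fun _ _ => Finset.abs_sum_le_sum_abs _ _)
    _ ≤ ∑ _i : Fin m, ∑ _j : Fin n, ‖A‖ * ‖X‖ := by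
        gcongr with i _ j _
        rw [abs_mul]
        exact mul_le_mul (Matrix.norm_entry_le_entrywise_sup_norm A)
          (Matrix.norm_entry_le_entrywise_sup_norm X) (abs_nonneg _) (norm_nonneg _)
    _ = m * n * ‖A‖ * ‖X‖ := by simp; ring

namespace IsMatrixNorm

variable {N : Matrix (Fin m) (Fin n) ℝ → ℝ}

lemma nonneg (hN : IsMatrixNorm N) (X : Matrix (Fin m) (Fin n) ℝ) : 0 ≤ N X := by
  obtain ⟨h0, hs, ht⟩ := hN
  have h1 := ht X ((-1 : ℝ) • X)
  have h2 : X + (-1 : ℝ) • X = 0 := by simp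
  rw [h2, (h0 0).2 rfl, hs] at h1
  norm_num at h1
  linarith

lemma pos (hN : IsMatrixNorm N) {X : Matrix (Fin m) (Fin n) ℝ} (hX : X ≠ 0) : 0 < N X :=
  (hN.nonneg X).lt_of_ne fun h => hX ((hN.1 X).1 h.symm)

lemma smul_of_nonneg (hN : IsMatrixNorm N) {c : ℝ} (hc : 0 ≤ c)
    (X : Matrix (Fin m) (Fin n) ℝ) : N (c • X) = c * N X := by
  rw [hN.2.1, abs_of_nonneg hc]

lemma convexOn (hN : IsMatrixNorm N) : ConvexOn ℝ Set.univ N := by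
  refine ⟨convex_univ, fun X _ Y _ a b ha hb _ => ?_⟩
  have h := hN.2.2 (a • X) (b • Y)
  rwa [hN.smul_of_nonneg ha, hN.smul_of_nonneg hb] at h

lemma continuous (hN : IsMatrixNorm N) : Continuous N :=
  continuousOn_univ.1 (hN.convexOn.continuousOn isOpen_univ)

lemma isCompact_ball (hN : IsMatrixNorm N) : IsCompact {Y | N Y ≤ 1} := by
  have : ProperSpace (Matrix (Fin m) (Fin n) ℝ) := FiniteDimensional.proper ℝ _
  obtain ⟨c, hc, hcN⟩ := (isCompact_sphere (0 : Matrix (Fin m) (Fin n) ℝ) 1).exists_forall_le'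
    hN.continuous.continuousOn (a := 0) fun X hX =>
      hN.pos (by rintro rfl; simp at hX)
  refine (isCompact_closedBall (0 : Matrix (Fin m) (Fin n) ℝ) c⁻¹).of_isClosed_subset
    (isClosed_le hN.continuous continuous_const) fun Y hY => ?_
  rw [mem_closedBall_zero_iff]
  rcases eq_or_ne Y 0 with rfl | hY0
  · simpa using hc.le
  have hpos : 0 < ‖Y‖ := norm_pos_iff.2 hY0
  have h := hcN (‖Y‖⁻¹ • Y) (by simp [norm_smul, hpos.ne'])
  rw [hN.smul_of_nonneg (inv_nonneg.2 hpos.le), inv_mul_eq_div, le_div_iff₀ hpos] at h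
  rw [le_inv_comm₀ hpos hc, ← one_div, le_div_iff₀ hpos]
  exact h.trans hY

lemma exists_isOptMax (hN : IsMatrixNorm N) (A : Matrix (Fin m) (Fin n) ℝ) :
    ∃ Y, IsOptMax N A Y := by
  obtain ⟨Y, hY, hmax⟩ := hN.isCompact_ball.exists_isMaxOn
    ⟨0, by simp [(hN.1 0).2 rfl]⟩ (continuous_mInner_right A).continuousOn
  exact ⟨Y, hY, fun Z hZ => hmax hZ⟩

end IsMatrixNorm

variable {N : Matrix (Fin m) (Fin n) ℝ → ℝ} {A : Matrix (Fin m) (Fin n) ℝ}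

lemma IsOptMax.mInner_eq {Y : Matrix (Fin m) (Fin n) ℝ} (hY : IsOptMax N A Y) :
    mInner A Y = dualNorm N A := by
  refine (IsGreatest.csSup_eq (s := {r | ∃ Z, N Z ≤ 1 ∧ r = mInner A Z})
    ⟨⟨Y, hY.1, rfl⟩, ?_⟩).symm
  rintro _ ⟨Z, hZ, rfl⟩
  exact hY.2 Z hZ

namespace IsMatrixNorm

lemma mInner_le_dualNorm (hN : IsMatrixNorm N) (A : Matrix (Fin m) (Fin n) ℝ)
    {Y : Matrix (Fin m) (Fin n) ℝ} (hY : N Y ≤ 1) : mInner A Y ≤ dualNorm N A := by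
  obtain ⟨Z, hZ⟩ := hN.exists_isOptMax A
  exact (hZ.2 Y hY).trans_eq hZ.mInner_eq

lemma isOptMax_iff (hN : IsMatrixNorm N) {Y : Matrix (Fin m) (Fin n) ℝ} :
    IsOptMax N A Y ↔ N Y ≤ 1 ∧ dualNorm N A ≤ mInner A Y :=
  ⟨fun h => ⟨h.1, h.mInner_eq.ge⟩,
    fun h => ⟨h.1, fun _ hZ => (hN.mInner_le_dualNorm A hZ).trans h.2⟩⟩

lemma mInner_le_dualNorm_mul (hN : IsMatrixNorm N) (A X : Matrix (Fin m) (Fin n) ℝ) :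
    mInner A X ≤ dualNorm N A * N X := by
  rcases eq_or_ne X 0 with rfl | hX
  · simp [mInner, (hN.1 0).2 rfl]
  have hpos := hN.pos hX
  have h := hN.mInner_le_dualNorm A (Y := (N X)⁻¹ • X)
    (by rw [hN.smul_of_nonneg (inv_nonneg.2 hpos.le), inv_mul_cancel₀ hpos.ne'])
  rwa [mInner_smul_right, inv_mul_eq_div, div_le_iff₀ hpos] at h

lemma dualNorm_pos (hN : IsMatrixNorm N) (hA : A ≠ 0) : 0 < dualNorm N A := by
  have h := hN.mInner_le_dualNorm_mul A A
  have h' := (mInner_self_nonneg A).lt_of_ne fun h => hA (mInner_self_eq_zero.1 h.symm)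
  exact pos_of_mul_pos_left (h'.trans_le h) (hN.nonneg A)

lemma isOptMin_iff (hN : IsMatrixNorm N) (hA : A ≠ 0) {X : Matrix (Fin m) (Fin n) ℝ} :
    IsOptMin N A X ↔ IsOptMax N A (dualNorm N A • X) := by
  have hd := hN.dualNorm_pos hA
  rw [hN.isOptMax_iff, hN.smul_of_nonneg hd.le, mInner_smul_right, le_mul_iff_one_le_right hd]
  refine ⟨fun h => ⟨?_, h.1⟩, fun h => ⟨h.2, fun Z hZ => ?_⟩⟩
  · obtain ⟨Y, hY⟩ := hN.exists_isOptMax A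
    have hle := h.2 ((dualNorm N A)⁻¹ • Y)
      (by rw [mInner_smul_right, hY.mInner_eq, inv_mul_cancel₀ hd.ne'])
    rw [hN.smul_of_nonneg (inv_nonneg.2 hd.le), inv_mul_eq_div, le_div_iff₀' hd] at hle
    exact hle.trans hY.1
  · exact le_of_mul_le_mul_left
      (h.1.trans (hZ.trans (hN.mInner_le_dualNorm_mul A Z))) hd

lemma existsUnique_isOptMin_iff (hN : IsMatrixNorm N) (hA : A ≠ 0) :
    (∃! X, IsOptMin N A X) ↔ ∃! Y, IsOptMax N A Y := by
  have hd := (hN.dualNorm_pos hA).ne'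
  simp only [hN.isOptMin_iff hA]
  exact (MulAction.bijective₀ hd).existsUnique_iff.symm

/-- A maximizer of `⟨A, ·⟩` over the unit ball is the only candidate for the gradient of the
dual norm at `A`. -/
lemma fderiv_dualNorm (hN : IsMatrixNorm N) (h : DifferentiableAt ℝ (dualNorm N) A)
    {Y : Matrix (Fin m) (Fin n) ℝ} (hY : IsOptMax N A Y) :
    fderiv ℝ (dualNorm N) A = mInnerCLM Y := by
  have hmin : IsLocalMin (fun B => dualNorm N B - mInnerCLM Y B) A :=
    Filter.Eventually.of_forall fun B => by
      have := hN.mInner_le_dualNorm B hY.1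
      simpa [hY.mInner_eq] using this
  exact sub_eq_zero.1 (hmin.hasFDerivAt_eq_zero (h.hasFDerivAt.sub (mInnerCLM Y).hasFDerivAt))

/-- If the maximizer `Y` of `⟨A, ·⟩` over the unit ball is unique, then any selection of maximizers
converges to `Y` at `A`. -/
lemma tendsto_of_isOptMax (hN : IsMatrixNorm N) {Y : Matrix (Fin m) (Fin n) ℝ}
    (hY : IsOptMax N A Y) (huniq : ∀ Z, IsOptMax N A Z → Z = Y)
    {y : Matrix (Fin m) (Fin n) ℝ → Matrix (Fin m) (Fin n) ℝ} (hy : ∀ B, IsOptMax N B (y B)) :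
    Filter.Tendsto y (nhds A) (nhds Y) := by
  obtain ⟨R, hR⟩ := hN.isCompact_ball.isBounded.exists_norm_le
  have hlim : Filter.Tendsto (fun B => mInner A (y B)) (nhds A) (nhds (dualNorm N A)) := by
    refine tendsto_of_tendsto_of_tendsto_of_le_of_le
      (g := fun B => dualNorm N A - m * n * ‖B - A‖ * (R + R)) ?_ tendsto_const_nhds
      (fun B => ?_) (fun B => hN.mInner_le_dualNorm A (hy B).1)
    · have hc : Continuous fun B : Matrix (Fin m) (Fin n) ℝ =>
          dualNorm N A - m * n * ‖B - A‖ * (R + R) := by fun_prop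
      simpa using hc.tendsto A
    · have h1 := (hy B).2 Y hY.1
      have h2 := (abs_le.1 (abs_mInner_le (B - A) (Y - y B))).1
      have h3 : m * n * ‖B - A‖ * ‖Y - y B‖ ≤ m * n * ‖B - A‖ * (R + R) := by
        gcongr
        exact (norm_sub_le _ _).trans (add_le_add (hR _ hY.1) (hR _ (hy B).1))
      simp only [mInner_sub_left, mInner_sub_right] at h2
      have h4 := hY.mInner_eq
      dsimp only
      linarith
  refine hN.isCompact_ball.tendsto_nhds_of_unique_mapClusterPt
    (Filter.Eventually.of_forall fun B => (hy B).1) fun Z hZ hcl => huniq Z ?_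
  have hcl' := hcl.continuousAt_comp (continuous_mInner_right A).continuousAt
  exact hN.isOptMax_iff.2 ⟨hZ, (eq_of_nhds_neBot (hcl'.clusterPt.mono hlim)).ge⟩

lemma hasFDerivAt_dualNorm (hN : IsMatrixNorm N) {Y : Matrix (Fin m) (Fin n) ℝ}
    (hY : IsOptMax N A Y) (huniq : ∀ Z, IsOptMax N A Z → Z = Y) :
    HasFDerivAt (dualNorm N) (mInnerCLM Y) A := by
  choose y hy using hN.exists_isOptMax
  have hlim := hN.tendsto_of_isOptMax hY huniq hy
  have hzero : Filter.Tendsto (fun B => m * n * ‖y B - Y‖) (nhds A) (nhds 0) := by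
    simpa using (tendsto_iff_norm_sub_tendsto_zero.1 hlim).const_mul (m * n : ℝ)
  refine hasFDerivAt_iff_isLittleO.2 (Asymptotics.isLittleO_iff.2 ?_)
  intro ε hε
  filter_upwards [hzero.eventually_le_const hε] with B hB
  have h1 := hN.mInner_le_dualNorm B hY.1
  have h2 := hN.mInner_le_dualNorm A (hy B).1
  have h3 := (abs_le.1 (abs_mInner_le (B - A) (y B - Y))).2
  have h4 := mul_le_mul_of_nonneg_right hB (norm_nonneg (B - A))
  have h5 := (hy B).mInner_eq
  have h6 := hY.mInner_eq
  simp only [mInner_sub_left, mInner_sub_right] at h3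
  change ‖dualNorm N B - dualNorm N A - mInner (B - A) Y‖ ≤ _
  rw [mInner_sub_left, Real.norm_of_nonneg (by linarith)]
  linarith

end IsMatrixNorm

theorem stmt3 (N : Matrix (Fin m) (Fin n) ℝ → ℝ) (hN : IsMatrixNorm N)
    (A : Matrix (Fin m) (Fin n) ℝ) (hA : A ≠ 0) :
    (∃! X, IsOptMin N A X) ↔ DifferentiableAt ℝ (dualNorm N) A := by
  rw [hN.existsUnique_isOptMin_iff hA]
  refine ⟨fun ⟨Y, hY, huniq⟩ => (hN.hasFDerivAt_dualNorm hY huniq).differentiableAt, fun h => ?_⟩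
  obtain ⟨Y, hY⟩ := hN.exists_isOptMax A
  exact ⟨Y, hY, fun Z hZ => mInnerCLM_injective
    ((hN.fderiv_dualNorm h hZ).symm.trans (hN.fderiv_dualNorm h hY))⟩

end LAROS
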